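/- arXiv:2505.18190 — 2 statements merged into one kernel-verified Lean document; each statement's English description precedes it below -/
import Mathlib

section
/- (Intermediate integral evaluation in Step 3 of the proof of Theorem 3.2.) For every real λ > 0, the interval integral ∫₀¹ λ / (t²·λ + (1−t)²) dt equals √λ · (arctan(√λ) + arctan(1/√λ)). -/
theorem flow_denom_ne_zero {s : ℝ} (hs : 0 < s) (t : ℝ) :
    t ^ 2 * s ^ 2 + (1 - t) ^ 2 ≠ 0 := by
  have : (s ^ 2 + 1) * (t ^ 2 * s ^ 2 + (1 - t) ^ 2) ≠ 0 := by
    rw [show (s ^ 2 + 1) * (t ^ 2 * s ^ 2 + (1 - t) ^ 2)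
      = s ^ 2 + ((s ^ 2 + 1) * t - 1) ^ 2 by ring]
    positivity
  exact right_ne_zero_of_mul this

/-- An antiderivative, obtained by completing the square:
`(s² + 1) (t² s² + (1 - t)²) = ((s² + 1) t - 1)² + s²`. -/
theorem hasDerivAt_mul_arctan_flow {s : ℝ} (hs : 0 < s) (t : ℝ) :
    HasDerivAt (fun t : ℝ => s * Real.arctan (((s ^ 2 + 1) * t - 1) / s))
      (s ^ 2 / (t ^ 2 * s ^ 2 + (1 - t) ^ 2)) t := by
  have hderiv :=
    (((((hasDerivAt_id t).const_mul (s ^ 2 + 1)).sub_const 1).div_const s).arctan).const_mul s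
  simp only [id_eq] at hderiv
  refine hderiv.congr_deriv ?_
  have hsq : (s ^ 2 + 1) * (t ^ 2 * s ^ 2 + (1 - t) ^ 2) = s ^ 2 + ((s ^ 2 + 1) * t - 1) ^ 2 := by
    ring
  have hden := flow_denom_ne_zero hs t
  have harg : 1 + (((s ^ 2 + 1) * t - 1) / s) ^ 2
      = (s ^ 2 + 1) * (t ^ 2 * s ^ 2 + (1 - t) ^ 2) / s ^ 2 := by
    rw [hsq]
    field_simp
  rw [harg]
  have hs1 : s ^ 2 + 1 ≠ 0 := by positivity
  field_simp

/-- Intermediate integral evaluation in Step 3 of the proof of Theorem 3.2: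
for `λ > 0`, `∫₀¹ λ/(t²λ + (1−t)²) dt = √λ (arctan √λ + arctan (1/√λ))`. -/
theorem flow_integral_arctan (lam : ℝ) (hlam : 0 < lam) :
    ∫ t in (0 : ℝ)..1, lam / (t ^ 2 * lam + (1 - t) ^ 2)
      = Real.sqrt lam *
        (Real.arctan (Real.sqrt lam) + Real.arctan (1 / Real.sqrt lam)) := by
  obtain ⟨s, hs, rfl⟩ : ∃ s : ℝ, 0 < s ∧ lam = s ^ 2 :=
    ⟨Real.sqrt lam, Real.sqrt_pos.2 hlam, (Real.sq_sqrt hlam.le).symm⟩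
  rw [Real.sqrt_sq hs.le]
  have hcont : Continuous fun t : ℝ => s ^ 2 / (t ^ 2 * s ^ 2 + (1 - t) ^ 2) :=
    continuous_const.div (by fun_prop) (flow_denom_ne_zero hs)
  rw [intervalIntegral.integral_eq_sub_of_hasDerivAt
    (fun t _ => hasDerivAt_mul_arctan_flow hs t) (hcont.intervalIntegrable 0 1)]
  have h1 : ((s ^ 2 + 1) * 1 - 1) / s = s := by
    field_simp
    ring
  have h0 : ((s ^ 2 + 1) * 0 - 1) / s = -(1 / s) := by ring
  rw [h1, h0, Real.arctan_neg]
  ring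
end

section
/- (Flow-loss formula of Theorem 3.2, eigenvalue form.) Let Σ be a real symmetric positive semidefinite d×d matrix with eigenvalues λ₁, …, λ_d (counted with multiplicity). Then ∫₀¹ tr(Σ·((1−t)²·I + t²·Σ)⁻¹) dt = (π/2) · Σ_{i=1}^{d} √λᵢ, where the matrix inverse is taken to be the zero matrix at any non-invertible point (which can occur only at the single point t = 1, a Lebesgue-null set). -/
open Matrix

/-- The trace of `A (a I + b A)⁻¹` for a Hermitian matrix `A`, in terms of its eigenvalues. -/
theorem Matrix.IsHermitian.trace_mul_inv_smul_one_add_smul {n : Type*} [Fintype n] [DecidableEq n]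
    {A : Matrix n n ℝ} (hA : A.IsHermitian) {a b : ℝ}
    (h : ∀ i, a + b * hA.eigenvalues i ≠ 0) :
    (A * (a • (1 : Matrix n n ℝ) + b • A)⁻¹).trace
      = ∑ i, hA.eigenvalues i / (a + b * hA.eigenvalues i) := by
  set φ := Unitary.conjStarAlgAut ℝ (Matrix n n ℝ) hA.eigenvectorUnitary
  have hφA : A = φ (diagonal hA.eigenvalues) := hA.spectral_theorem
  have hφ (X : Matrix n n ℝ) : (φ X).trace = X.trace := by
    rw [Unitary.conjStarAlgAut_apply, trace_mul_comm, ← mul_assoc, Unitary.coe_star_mul_self,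
      one_mul]
  have hcomb : a • (1 : Matrix n n ℝ) + b • A
      = φ (diagonal fun i => a + b * hA.eigenvalues i) := by
    have hdiag : (diagonal fun i => a + b * hA.eigenvalues i)
        = a • (1 : Matrix n n ℝ) + b • diagonal hA.eigenvalues := by
      rw [← diagonal_one, ← diagonal_smul, ← diagonal_smul, diagonal_add]
      congr 1
      ext i
      simp
    rw [hdiag, map_add, map_smul, map_smul, map_one, ← hφA]
  have hinv : (a • (1 : Matrix n n ℝ) + b • A)⁻¹
      = φ (diagonal fun i => (a + b * hA.eigenvalues i)⁻¹) := by
    refine inv_eq_right_inv ?_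
    rw [hcomb, ← map_mul, diagonal_mul_diagonal]
    simp only [mul_inv_cancel₀ (h _), diagonal_one, map_one]
  calc (A * (a • (1 : Matrix n n ℝ) + b • A)⁻¹).trace
      = (φ (diagonal hA.eigenvalues *
          diagonal fun i => (a + b * hA.eigenvalues i)⁻¹)).trace := by
        rw [hinv, map_mul, ← hφA]
    _ = _ := by
        rw [hφ, diagonal_mul_diagonal, trace_diagonal]
        simp only [div_eq_mul_inv]

theorem one_sub_sq_add_sq_mul_pos {l : ℝ} (hl : 0 < l) (t : ℝ) :
    0 < (1 - t) ^ 2 + t ^ 2 * l := by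
  rcases eq_or_ne t 0 with rfl | ht
  · norm_num
  · positivity

theorem intervalIntegrable_div_one_sub_sq_add {l : ℝ} (hl : 0 ≤ l) (a b : ℝ) :
    IntervalIntegrable (fun t : ℝ => l / ((1 - t) ^ 2 + t ^ 2 * l)) MeasureTheory.volume a b := by
  rcases hl.eq_or_lt with rfl | hl
  · simp
  · refine Continuous.intervalIntegrable ?_ a b
    exact Continuous.div (by fun_prop) (by fun_prop) fun t => (one_sub_sq_add_sq_mul_pos hl t).ne'

theorem integral_div_one_sub_sq_add {l : ℝ} (hl : 0 ≤ l) :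
    ∫ t in (0 : ℝ)..1, l / ((1 - t) ^ 2 + t ^ 2 * l) = Real.pi / 2 * Real.sqrt l := by
  have hint := intervalIntegrable_div_one_sub_sq_add hl 0 1
  rcases hl.eq_or_lt with rfl | hl
  · simp
  obtain ⟨s, hs, rfl⟩ : ∃ s : ℝ, 0 < s ∧ s ^ 2 = l :=
    ⟨√l, Real.sqrt_pos.2 hl, Real.sq_sqrt hl.le⟩
  have hderiv (t : ℝ) : HasDerivAt (fun t => s * Real.arctan (((1 + s ^ 2) * t - 1) / s))
      (s ^ 2 / ((1 - t) ^ 2 + t ^ 2 * s ^ 2)) t := by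
    have h :=
      ((((hasDerivAt_id t).const_mul (1 + s ^ 2)).sub_const 1).div_const s).arctan.const_mul s
    refine h.congr_deriv ?_
    have h₁ := (one_sub_sq_add_sq_mul_pos hl t).ne'
    have h₂ : 1 + (((1 + s ^ 2) * t - 1) / s) ^ 2
        = (1 + s ^ 2) * ((1 - t) ^ 2 + t ^ 2 * s ^ 2) / s ^ 2 := by
      field_simp
      ring
    have h₃ : 1 + s ^ 2 ≠ 0 := by positivity
    simp only [id, h₂]
    field_simp
  rw [intervalIntegral.integral_eq_sub_of_hasDerivAt (fun t _ => hderiv t) hint,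
    Real.sqrt_sq hs.le]
  have h₁ : ((1 + s ^ 2) * 1 - 1) / s = s := by
    field_simp
    ring
  have h₀ : ((1 + s ^ 2) * 0 - 1) / s = -s⁻¹ := by
    field_simp
    ring
  rw [h₁, h₀, Real.arctan_neg, Real.arctan_inv_of_pos hs]
  ring

/-- Flow-loss formula of Theorem 3.2 (eigenvalue form): for `Σ` real symmetric PSD with
eigenvalues `λᵢ`, `∫₀¹ tr(Σ((1−t)²I + t²Σ)⁻¹) dt = (π/2) Σᵢ √λᵢ` (Mathlib's matrix
inverse is zero at non-invertible points, which occur only on a null set). -/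
theorem flow_loss_eigenvalue_form {d : ℕ} (S : Matrix (Fin d) (Fin d) ℝ)
    (hS : S.PosSemidef) :
    ∫ t in (0 : ℝ)..1,
        (S * ((1 - t) ^ 2 • (1 : Matrix (Fin d) (Fin d) ℝ) + t ^ 2 • S)⁻¹).trace
      = Real.pi / 2 * ∑ i, Real.sqrt (hS.1.eigenvalues i) := by
  have hcongr : ∫ t in (0 : ℝ)..1,
        (S * ((1 - t) ^ 2 • (1 : Matrix (Fin d) (Fin d) ℝ) + t ^ 2 • S)⁻¹).trace
      = ∫ t in (0 : ℝ)..1,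
        ∑ i, hS.1.eigenvalues i / ((1 - t) ^ 2 + t ^ 2 * hS.1.eigenvalues i) := by
    refine intervalIntegral.integral_congr_ae ?_
    filter_upwards [MeasureTheory.Measure.ae_ne MeasureTheory.volume (1 : ℝ)] with t ht _
    refine hS.1.trace_mul_inv_smul_one_add_smul fun i => ne_of_gt ?_
    have hpos : 0 < (1 - t) ^ 2 := sq_pos_of_ne_zero (sub_ne_zero.2 ht.symm)
    have := hS.eigenvalues_nonneg i
    positivity
  rw [hcongr, intervalIntegral.integral_finsetSum fun i _ =>
    intervalIntegrable_div_one_sub_sq_add (hS.eigenvalues_nonneg i) 0 1, Finset.mul_sum]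
  exact Finset.sum_congr rfl fun i _ => integral_div_one_sub_sq_add (hS.eigenvalues_nonneg i)
end
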